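/- arXiv:2405.10549 — 5 statements merged into one kernel-verified Lean document; each statement's English description precedes it below -/
import Mathlib

section
/- Let m > 0, let n₁, n₂, n₃ : ℝ² → ℝ be continuously differentiable functions with n₁(x)² + n₂(x)² + n₃(x)² = 1 for every x ∈ ℝ², and let ψ : ℝ² → ℂ⁴ be twice continuously differentiable. Define (Hψ)(x) := −i(σ₂ ⊗ 1₂)(∂ψ/∂x₁)(x) + i(σ₁ ⊗ 1₂)(∂ψ/∂x₂)(x) − m Σ_{j=1}^{3} n_j(x)(σ₃ ⊗ τ_j)ψ(x). Then H(Hψ) is well defined and for every x ∈ ℝ², (H(Hψ))(x) = −(∂²ψ/∂x₁²)(x) − (∂²ψ/∂x₂²)(x) + m²ψ(x) − m Σ_{j=1}^{3} [ (∂n_j/∂x₁)(x)(σ₁ ⊗ τ_j) + (∂n_j/∂x₂)(x)(σ₂ ⊗ τ_j) ] ψ(x). -/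
open Matrix Kronecker

noncomputable section

/-- The Pauli matrices `σ₁ = τ₁, σ₂ = τ₂, σ₃ = τ₃`. -/
def σ1 : Matrix (Fin 2) (Fin 2) ℂ := !![0, 1; 1, 0]
def σ2 : Matrix (Fin 2) (Fin 2) ℂ := !![0, -Complex.I; Complex.I, 0]
def σ3 : Matrix (Fin 2) (Fin 2) ℂ := !![1, 0; 0, -1]

def τ : Fin 3 → Matrix (Fin 2) (Fin 2) ℂ := ![σ1, σ2, σ3]

/-- `M *ᵥ ·` as a real continuous linear map. -/
def mulVecCLM {ι : Type*} [Fintype ι] (M : Matrix ι ι ℂ) : (ι → ℂ) →L[ℝ] (ι → ℂ) :=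
  LinearMap.toContinuousLinearMap (M.mulVecLin.restrictScalars ℝ)

theorem mulVecCLM_apply {ι : Type*} [Fintype ι] (M : Matrix ι ι ℂ) (v : ι → ℂ) :
    mulVecCLM M v = M *ᵥ v := rfl

section Calculus

variable {E ι : Type*} [NormedAddCommGroup E] [NormedSpace ℝ E] [Fintype ι]

theorem contDiff_mulVec {k : WithTop ℕ∞} (M : Matrix ι ι ℂ) {f : E → ι → ℂ}
    (hf : ContDiff ℝ k f) : ContDiff ℝ k (fun y => M *ᵥ f y) :=
  (mulVecCLM M).contDiff.comp hf

theorem fderiv_mulVec (M : Matrix ι ι ℂ) {f : E → ι → ℂ} {x : E}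
    (hf : DifferentiableAt ℝ f x) (v : E) :
    fderiv ℝ (fun y => M *ᵥ f y) x v = M *ᵥ fderiv ℝ f x v := by
  have h := ((mulVecCLM M).hasFDerivAt (x := f x)).comp x hf.hasFDerivAt
  have h' : HasFDerivAt (fun y => M *ᵥ f y) ((mulVecCLM M).comp (fderiv ℝ f x)) x := h
  rw [h'.fderiv, ContinuousLinearMap.comp_apply, mulVecCLM_apply]

theorem contDiff_ofReal_smul {k : WithTop ℕ∞} {g : E → ℝ} {f : E → ι → ℂ}
    (hg : ContDiff ℝ k g) (hf : ContDiff ℝ k f) :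
    ContDiff ℝ k (fun y => ((g y : ℝ) : ℂ) • f y) := by
  simp only [Complex.coe_smul]
  exact hg.smul hf

theorem fderiv_ofReal_smul {g : E → ℝ} {f : E → ι → ℂ} {x : E}
    (hg : DifferentiableAt ℝ g x) (hf : DifferentiableAt ℝ f x) (v : E) :
    fderiv ℝ (fun y => ((g y : ℝ) : ℂ) • f y) x v =
      ((g x : ℝ) : ℂ) • fderiv ℝ f x v + ((fderiv ℝ g x v : ℝ) : ℂ) • f x := by
  simp only [Complex.coe_smul]
  rw [fderiv_fun_smul hg hf]
  simp

/-- Mixed directional derivatives of a `C²` function commute. -/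
theorem fderiv_fderiv_apply_comm {F : Type*} [NormedAddCommGroup F] [NormedSpace ℝ F]
    {f : E → F} (hf : ContDiff ℝ 2 f) (x u v : E) :
    fderiv ℝ (fun y => fderiv ℝ f y u) x v = fderiv ℝ (fun y => fderiv ℝ f y v) x u := by
  have hd : DifferentiableAt ℝ (fderiv ℝ f) x :=
    ((hf.fderiv_right (m := 1) (by norm_num)).differentiable one_ne_zero) x
  have key (w z : E) :
      fderiv ℝ (fun y => fderiv ℝ f y w) x z = fderiv ℝ (fderiv ℝ f) x z w := by
    rw [fderiv_clm_apply hd (differentiableAt_const w)]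
    simp
  rw [key, key]
  exact (hf.contDiffAt.isSymmSndFDerivAt (by simp)) v u

end Calculus

theorem kronecker_mulVec_apply (A B : Matrix (Fin 2) (Fin 2) ℂ) (v : Fin 2 × Fin 2 → ℂ)
    (i j : Fin 2) :
    ((A ⊗ₖ B) *ᵥ v) (i, j) =
      A i 0 * (B j 0 * v (0, 0) + B j 1 * v (0, 1))
        + A i 1 * (B j 0 * v (1, 0) + B j 1 * v (1, 1)) := by
  simp only [Matrix.mulVec, dotProduct, Fintype.sum_prod_type, Fin.sum_univ_two,
    Matrix.kroneckerMap_apply]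
  ring

theorem σ1_kronecker_mulVec_zero (B : Matrix (Fin 2) (Fin 2) ℂ) (v : Fin 2 × Fin 2 → ℂ)
    (j : Fin 2) : ((σ1 ⊗ₖ B) *ᵥ v) (0, j) = B j 0 * v (1, 0) + B j 1 * v (1, 1) := by
  simp [kronecker_mulVec_apply, σ1]

theorem σ1_kronecker_mulVec_one (B : Matrix (Fin 2) (Fin 2) ℂ) (v : Fin 2 × Fin 2 → ℂ)
    (j : Fin 2) : ((σ1 ⊗ₖ B) *ᵥ v) (1, j) = B j 0 * v (0, 0) + B j 1 * v (0, 1) := by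
  simp [kronecker_mulVec_apply, σ1]

theorem σ2_kronecker_mulVec_zero (B : Matrix (Fin 2) (Fin 2) ℂ) (v : Fin 2 × Fin 2 → ℂ)
    (j : Fin 2) :
    ((σ2 ⊗ₖ B) *ᵥ v) (0, j) = -Complex.I * (B j 0 * v (1, 0) + B j 1 * v (1, 1)) := by
  simp [kronecker_mulVec_apply, σ2]

theorem σ2_kronecker_mulVec_one (B : Matrix (Fin 2) (Fin 2) ℂ) (v : Fin 2 × Fin 2 → ℂ)
    (j : Fin 2) :
    ((σ2 ⊗ₖ B) *ᵥ v) (1, j) = Complex.I * (B j 0 * v (0, 0) + B j 1 * v (0, 1)) := by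
  simp [kronecker_mulVec_apply, σ2]

theorem σ3_kronecker_mulVec_zero (B : Matrix (Fin 2) (Fin 2) ℂ) (v : Fin 2 × Fin 2 → ℂ)
    (j : Fin 2) : ((σ3 ⊗ₖ B) *ᵥ v) (0, j) = B j 0 * v (0, 0) + B j 1 * v (0, 1) := by
  simp [kronecker_mulVec_apply, σ3]

theorem σ3_kronecker_mulVec_one (B : Matrix (Fin 2) (Fin 2) ℂ) (v : Fin 2 × Fin 2 → ℂ)
    (j : Fin 2) : ((σ3 ⊗ₖ B) *ᵥ v) (1, j) = -(B j 0 * v (1, 0) + B j 1 * v (1, 1)) := by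
  simp [kronecker_mulVec_apply, σ3]

/-- The pointwise identity behind `H² = -Δ + m² - …`: `a`, `b` stand for the first derivatives of `p`,
and `c`, `d`, `e` for its second derivatives in the directions `11`, `12`, `22`. -/
theorem dirac_sq_algebra (m : ℂ) (n n₁ n₂ : Fin 3 → ℂ)
    (hunit : n 0 ^ 2 + n 1 ^ 2 + n 2 ^ 2 = 1) (p a b c d e : Fin 2 × Fin 2 → ℂ) :
    (-Complex.I) • ((σ2 ⊗ₖ (1 : Matrix (Fin 2) (Fin 2) ℂ)) *ᵥ
        ((-Complex.I) • ((σ2 ⊗ₖ (1 : Matrix (Fin 2) (Fin 2) ℂ)) *ᵥ c)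
        + Complex.I • ((σ1 ⊗ₖ (1 : Matrix (Fin 2) (Fin 2) ℂ)) *ᵥ d)
        - m • ∑ j : Fin 3, (n j • ((σ3 ⊗ₖ τ j) *ᵥ a) + n₁ j • ((σ3 ⊗ₖ τ j) *ᵥ p))))
      + Complex.I • ((σ1 ⊗ₖ (1 : Matrix (Fin 2) (Fin 2) ℂ)) *ᵥ
        ((-Complex.I) • ((σ2 ⊗ₖ (1 : Matrix (Fin 2) (Fin 2) ℂ)) *ᵥ d)
        + Complex.I • ((σ1 ⊗ₖ (1 : Matrix (Fin 2) (Fin 2) ℂ)) *ᵥ e)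
        - m • ∑ j : Fin 3, (n j • ((σ3 ⊗ₖ τ j) *ᵥ b) + n₂ j • ((σ3 ⊗ₖ τ j) *ᵥ p))))
      - m • ∑ j : Fin 3, n j • ((σ3 ⊗ₖ τ j) *ᵥ
        ((-Complex.I) • ((σ2 ⊗ₖ (1 : Matrix (Fin 2) (Fin 2) ℂ)) *ᵥ a)
        + Complex.I • ((σ1 ⊗ₖ (1 : Matrix (Fin 2) (Fin 2) ℂ)) *ᵥ b)
        - m • ∑ j : Fin 3, n j • ((σ3 ⊗ₖ τ j) *ᵥ p))) =
    -c - e + m ^ 2 • p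
      - m • ∑ j : Fin 3, (n₁ j • ((σ1 ⊗ₖ τ j) *ᵥ p) + n₂ j • ((σ2 ⊗ₖ τ j) *ᵥ p)) := by
  have hI : Complex.I ^ 2 = -1 := Complex.I_sq
  have hI3 : Complex.I ^ 3 = -Complex.I := Complex.I_pow_three
  have hI4 : Complex.I ^ 4 = 1 := Complex.I_pow_four
  ext ⟨k, l⟩
  have t0 : τ 0 = !![0, 1; 1, 0] := rfl
  have t1 : τ 1 = !![0, -Complex.I; Complex.I, 0] := rfl
  have t2 : τ 2 = !![1, 0; 0, -1] := rfl
  have o00 : (1 : Matrix (Fin 2) (Fin 2) ℂ) 0 0 = 1 := rfl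
  have o01 : (1 : Matrix (Fin 2) (Fin 2) ℂ) 0 1 = 0 := rfl
  have o10 : (1 : Matrix (Fin 2) (Fin 2) ℂ) 1 0 = 0 := rfl
  have o11 : (1 : Matrix (Fin 2) (Fin 2) ℂ) 1 1 = 1 := rfl
  fin_cases k <;> fin_cases l <;>
  · simp only [Fin.zero_eta, Fin.mk_one, Fin.sum_univ_three, Pi.add_apply, Pi.sub_apply,
      Pi.neg_apply, Pi.smul_apply, smul_eq_mul, σ1_kronecker_mulVec_zero,
      σ1_kronecker_mulVec_one, σ2_kronecker_mulVec_zero, σ2_kronecker_mulVec_one,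
      σ3_kronecker_mulVec_zero, σ3_kronecker_mulVec_one, o00, o01, o10, o11, t0, t1, t2,
      Matrix.of_apply, Matrix.cons_val_zero, Matrix.cons_val_one, Matrix.cons_val_fin_one,
      zero_mul, one_mul, zero_add, add_zero]
    ring_nf
    simp only [hI, hI3, hI4]
    first
      | linear_combination (m ^ 2 * p (0, 0)) * hunit
      | linear_combination (m ^ 2 * p (0, 1)) * hunit
      | linear_combination (m ^ 2 * p (1, 0)) * hunit
      | linear_combination (m ^ 2 * p (1, 1)) * hunit

/-- Let `m > 0`, let `n₁, n₂, n₃ : ℝ² → ℝ` be `C¹` with `n₁² + n₂² + n₃² = 1`, let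
`ψ : ℝ² → ℂ⁴` be `C²`, and let
`Hψ = −i(σ₂⊗1)∂₁ψ + i(σ₁⊗1)∂₂ψ − m Σⱼ nⱼ (σ₃⊗τⱼ) ψ`.
Then `H(Hψ)` is well defined and
`H(Hψ) = −∂₁²ψ − ∂₂²ψ + m²ψ − m Σⱼ ((∂₁nⱼ)(σ₁⊗τⱼ) + (∂₂nⱼ)(σ₂⊗τⱼ)) ψ`. -/
theorem stmt_0 (m : ℝ) (hm : 0 < m)
    (n : Fin 3 → ℝ × ℝ → ℝ) (hn : ∀ j, ContDiff ℝ 1 (n j))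
    (hunit : ∀ x, (n 0 x) ^ 2 + (n 1 x) ^ 2 + (n 2 x) ^ 2 = 1)
    (ψ : ℝ × ℝ → (Fin 2 × Fin 2) → ℂ) (hψ : ContDiff ℝ 2 ψ)
    (Hop : ((ℝ × ℝ) → (Fin 2 × Fin 2) → ℂ) → ((ℝ × ℝ) → (Fin 2 × Fin 2) → ℂ))
    (hHop : ∀ χ : (ℝ × ℝ) → (Fin 2 × Fin 2) → ℂ, ∀ x : ℝ × ℝ, Hop χ x =
      (-Complex.I) • ((σ2 ⊗ₖ (1 : Matrix (Fin 2) (Fin 2) ℂ)) *ᵥ fderiv ℝ χ x (1, 0))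
        + Complex.I • ((σ1 ⊗ₖ (1 : Matrix (Fin 2) (Fin 2) ℂ)) *ᵥ fderiv ℝ χ x (0, 1))
        - (m : ℂ) • ∑ j : Fin 3, ((n j x : ℝ) : ℂ) • ((σ3 ⊗ₖ τ j) *ᵥ χ x)) :
    ContDiff ℝ 1 (Hop ψ) ∧
    ∀ x : ℝ × ℝ, Hop (Hop ψ) x =
      -(fderiv ℝ (fun y => fderiv ℝ ψ y (1, 0)) x (1, 0))
        - fderiv ℝ (fun y => fderiv ℝ ψ y (0, 1)) x (0, 1)
        + ((m : ℂ) ^ 2) • ψ x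
        - (m : ℂ) • ∑ j : Fin 3,
            (((fderiv ℝ (n j) x (1, 0) : ℝ) : ℂ) • ((σ1 ⊗ₖ τ j) *ᵥ ψ x)
              + ((fderiv ℝ (n j) x (0, 1) : ℝ) : ℂ) • ((σ2 ⊗ₖ τ j) *ᵥ ψ x)) := by
  have hd (v : ℝ × ℝ) : ContDiff ℝ 1 (fun y => fderiv ℝ ψ y v) :=
    (hψ.fderiv_right (m := 1) (by norm_num)).clm_apply contDiff_const
  have hψ1 : ContDiff ℝ 1 ψ := hψ.of_le (by norm_num)
  have hA := (contDiff_mulVec (σ2 ⊗ₖ (1 : Matrix (Fin 2) (Fin 2) ℂ)) (hd (1, 0))).const_smul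
    (-Complex.I)
  have hB := (contDiff_mulVec (σ1 ⊗ₖ (1 : Matrix (Fin 2) (Fin 2) ℂ)) (hd (0, 1))).const_smul
    Complex.I
  have hV (j : Fin 3) := contDiff_mulVec (σ3 ⊗ₖ τ j) hψ1
  have hN (j : Fin 3) := contDiff_ofReal_smul (hn j) (hV j)
  have hS := ContDiff.sum (s := Finset.univ) fun j _ => hN j
  have hC := hS.const_smul (m : ℂ)
  have hHψ := funext (hHop ψ)
  refine ⟨hHψ ▸ (hA.add hB).sub hC, fun x => ?_⟩
  have diff {f : ℝ × ℝ → Fin 2 × Fin 2 → ℂ} (hf : ContDiff ℝ 1 f) : DifferentiableAt ℝ f x :=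
    hf.differentiable one_ne_zero x
  have hderiv (v : ℝ × ℝ) : fderiv ℝ (Hop ψ) x v =
      (-Complex.I) • ((σ2 ⊗ₖ (1 : Matrix (Fin 2) (Fin 2) ℂ)) *ᵥ
          fderiv ℝ (fun y => fderiv ℝ ψ y (1, 0)) x v)
        + Complex.I • ((σ1 ⊗ₖ (1 : Matrix (Fin 2) (Fin 2) ℂ)) *ᵥ
          fderiv ℝ (fun y => fderiv ℝ ψ y (0, 1)) x v)
        - (m : ℂ) • ∑ j : Fin 3, (((n j x : ℝ) : ℂ) • ((σ3 ⊗ₖ τ j) *ᵥ fderiv ℝ ψ x v)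
          + ((fderiv ℝ (n j) x v : ℝ) : ℂ) • ((σ3 ⊗ₖ τ j) *ᵥ ψ x)) := by
    rw [hHψ]
    erw [fderiv_fun_sub (diff (hA.add hB)) (diff hC), fderiv_fun_add (diff hA) (diff hB),
      fderiv_fun_const_smul (diff (contDiff_mulVec _ (hd _))),
      fderiv_fun_const_smul (diff (contDiff_mulVec _ (hd _))),
      fderiv_fun_const_smul (diff hS), fderiv_fun_sum fun j _ => diff (hN j)]
    simp only [_root_.sub_apply, _root_.add_apply, _root_.smul_apply,
      _root_.sum_apply]
    rw [fderiv_mulVec _ (diff (hd _)), fderiv_mulVec _ (diff (hd _))]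
    simp only [fderiv_ofReal_smul ((hn _).differentiable one_ne_zero x) (diff (hV _)),
      fderiv_mulVec _ (diff hψ1)]
  rw [hHop (Hop ψ) x, hderiv, hderiv, hHop ψ x,
    fderiv_fderiv_apply_comm hψ x (0, 1) (1, 0)]
  exact dirac_sq_algebra m (fun j => n j x) (fun j => (fderiv ℝ (n j) x (1, 0) : ℝ))
    (fun j => (fderiv ℝ (n j) x (0, 1) : ℝ)) (by exact_mod_cast hunit x) (ψ x) _ _ _ _ _

end
end

section
/- Let N ∈ ℤ and let F : (0,∞) → ℝ be continuously differentiable with F'(r) → 0 as r → ∞. For x = (x₁, x₂) ∈ ℝ² such that x₁ + i x₂ is not a nonpositive real number, define n₁(x) = sin(F(‖x‖)) · cos(N · arg(x₁ + i x₂)), n₂(x) = sin(F(‖x‖)) · sin(N · arg(x₁ + i x₂)), n₃(x) = cos(F(‖x‖)), where arg is the principal argument. Then each n_j is differentiable at every such x, and for every ε > 0 there exists R > 0 such that for all x with ‖x‖ ≥ R and x₁ + i x₂ not a nonpositive real number, ‖(Dn_j)(x)‖ ≤ ε for j = 1, 2, 3 (where Dn_j denotes the Fréchet derivative, i.e. the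 gradient). -/
open scoped Topology

section PolarDerivatives

variable {E : Type*} [NormedAddCommGroup E]

/-- Composing with the norm does not increase the size of the derivative. -/
theorem exists_hasFDerivAt_comp_norm [InnerProductSpace ℝ E] {F : ℝ → ℝ} {x : E} (hx : x ≠ 0)
    (hF : DifferentiableAt ℝ F ‖x‖) :
    ∃ D : E →L[ℝ] ℝ, HasFDerivAt (fun y ↦ F ‖y‖) D x ∧ ‖D‖ ≤ |deriv F ‖x‖| := by
  have hnorm : HasFDerivAt (fun y : E ↦ ‖y‖) (fderiv ℝ (fun y : E ↦ ‖y‖) x) x :=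
    (differentiableAt_id.norm ℝ hx).hasFDerivAt
  refine ⟨_, hF.hasDerivAt.comp_hasFDerivAt x hnorm, ?_⟩
  rw [norm_smul, Real.norm_eq_abs]
  refine mul_le_of_le_one_right (abs_nonneg _) ?_
  simpa using hnorm.le_of_lipschitz lipschitzWith_one_norm

theorem exists_hasFDerivAt_arg {z : ℂ} (hz : z ∈ Complex.slitPlane) :
    ∃ D : ℂ →L[ℝ] ℝ, HasFDerivAt Complex.arg D z ∧ ‖D‖ ≤ ‖z‖⁻¹ := by
  have hlog := (Complex.hasStrictFDerivAt_log_real hz).hasFDerivAt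
  refine ⟨_, (Complex.imCLM.hasFDerivAt.comp z hlog).congr_of_eventuallyEq
    (Filter.Eventually.of_forall fun w ↦ (Complex.log_im w).symm), ?_⟩
  refine (ContinuousLinearMap.opNorm_comp_le _ _).trans ?_
  rw [Complex.imCLM_norm, one_mul, norm_smul, norm_inv]
  refine mul_le_of_le_one_right (by positivity) ?_
  exact ContinuousLinearMap.opNorm_le_bound _ zero_le_one fun w ↦ by simp

variable [NormedSpace ℝ E]

theorem exists_hasFDerivAt_comp_mul_comp {a b : ℝ → ℝ} {a' b' : ℝ} {u v : E → ℝ}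
    {u' v' : E →L[ℝ] ℝ} {x : E} (hu : HasFDerivAt u u' x) (hv : HasFDerivAt v v' x)
    (ha : HasDerivAt a a' (u x)) (hb : HasDerivAt b b' (v x))
    (ha_le : |a (u x)| ≤ 1) (hb_le : |b (v x)| ≤ 1) (ha'_le : |a'| ≤ 1) (hb'_le : |b'| ≤ 1) :
    ∃ D : E →L[ℝ] ℝ, HasFDerivAt (fun y ↦ a (u y) * b (v y)) D x ∧ ‖D‖ ≤ ‖u'‖ + ‖v'‖ := by
  refine ⟨_, (ha.comp_hasFDerivAt x hu).mul (hb.comp_hasFDerivAt x hv), ?_⟩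
  refine (norm_add_le _ _).trans ?_
  simp only [norm_smul, Real.norm_eq_abs, Function.comp_apply]
  rw [add_comm ‖u'‖]
  gcongr
  · calc |a (u x)| * (|b'| * ‖v'‖) ≤ 1 * (1 * ‖v'‖) := by gcongr
      _ = ‖v'‖ := by ring
  · calc |b (v x)| * (|a'| * ‖u'‖) ≤ 1 * (1 * ‖u'‖) := by gcongr
      _ = ‖u'‖ := by ring

end PolarDerivatives

/-- In polar coordinates, the angle has gradient of size at most `1 / r`. -/
theorem exists_hasFDerivAt_polar_angle {x : EuclideanSpace ℝ (Fin 2)}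
    (hx : ¬ (x 1 = 0 ∧ x 0 ≤ 0)) (c : ℝ) :
    ∃ D : EuclideanSpace ℝ (Fin 2) →L[ℝ] ℝ,
      HasFDerivAt (fun y : EuclideanSpace ℝ (Fin 2) ↦
        c * Complex.arg ((y 0 : ℂ) + (y 1 : ℂ) * Complex.I)) D x ∧ ‖D‖ ≤ |c| * ‖x‖⁻¹ := by
  let L := Complex.orthonormalBasisOneI.repr.symm
  have hL (y : EuclideanSpace ℝ (Fin 2)) : L y = (y 0 : ℂ) + (y 1 : ℂ) * Complex.I :=
    Complex.orthonormalBasisOneI_repr_symm_apply y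
  have hslit : L x ∈ Complex.slitPlane := by
    rw [hL, Complex.mem_slitPlane_iff]
    by_contra! h
    exact hx ⟨by simpa using h.2, by simpa using h.1⟩
  obtain ⟨D, hD, hD_le⟩ := exists_hasFDerivAt_arg hslit
  rw [L.norm_map] at hD_le
  have hcomp := hD.comp x L.toContinuousLinearEquiv.hasFDerivAt
  refine ⟨_, (hcomp.const_mul c).congr_of_eventuallyEq
    (Filter.Eventually.of_forall fun y ↦ by simp [← hL]), ?_⟩
  rw [norm_smul, Real.norm_eq_abs]
  gcongr
  refine le_trans (ContinuousLinearMap.opNorm_le_bound _ (norm_nonneg D) fun y ↦ ?_) hD_le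
  simpa using D.le_opNorm (L y)

theorem isOpen_compl_nonpos_axis :
    IsOpen {x : EuclideanSpace ℝ (Fin 2) | ¬ (x 1 = 0 ∧ x 0 ≤ 0)} := by
  have h₁ : IsClosed {x : EuclideanSpace ℝ (Fin 2) | x 1 = 0} :=
    isClosed_eq (by fun_prop) (by fun_prop)
  have h₀ : IsClosed {x : EuclideanSpace ℝ (Fin 2) | x 0 ≤ 0} :=
    isClosed_le (by fun_prop) (by fun_prop)
  exact (h₁.inter h₀).isOpen_compl

/-- Let `N ∈ ℤ` and let `F` be continuously differentiable on `(0,∞)` with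
`F'(r) → 0` as `r → ∞`.  Define, away from the nonpositive real axis,
`n₁(x) = sin(F(‖x‖)) cos(N arg(x₁+ix₂))`, `n₂(x) = sin(F(‖x‖)) sin(N arg(x₁+ix₂))`,
`n₃(x) = cos(F(‖x‖))`.  Then each `nⱼ` is differentiable at every such point, and the
Fréchet derivatives tend to `0` in norm as `‖x‖ → ∞`. -/
theorem stmt_2 (N : ℤ) (F : ℝ → ℝ)
    (hF : ContDiffOn ℝ 1 F (Set.Ioi 0))
    (hF' : Filter.Tendsto (deriv F) Filter.atTop (𝓝 0))
    (n : Fin 3 → EuclideanSpace ℝ (Fin 2) → ℝ)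
    (hn0 : ∀ x : EuclideanSpace ℝ (Fin 2), ¬ (x 1 = 0 ∧ x 0 ≤ 0) →
      n 0 x = Real.sin (F ‖x‖)
          * Real.cos (N * Complex.arg ((x 0 : ℂ) + (x 1 : ℂ) * Complex.I)))
    (hn1 : ∀ x : EuclideanSpace ℝ (Fin 2), ¬ (x 1 = 0 ∧ x 0 ≤ 0) →
      n 1 x = Real.sin (F ‖x‖)
          * Real.sin (N * Complex.arg ((x 0 : ℂ) + (x 1 : ℂ) * Complex.I)))
    (hn2 : ∀ x : EuclideanSpace ℝ (Fin 2), ¬ (x 1 = 0 ∧ x 0 ≤ 0) →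
      n 2 x = Real.cos (F ‖x‖)) :
    (∀ x : EuclideanSpace ℝ (Fin 2), ¬ (x 1 = 0 ∧ x 0 ≤ 0) →
        ∀ j : Fin 3, DifferentiableAt ℝ (n j) x)
    ∧ ∀ ε : ℝ, 0 < ε → ∃ R : ℝ, 0 < R ∧
        ∀ x : EuclideanSpace ℝ (Fin 2), R ≤ ‖x‖ → ¬ (x 1 = 0 ∧ x 0 ≤ 0) →
          ∀ j : Fin 3, ‖fderiv ℝ (n j) x‖ ≤ ε := by
  have key : ∀ x : EuclideanSpace ℝ (Fin 2), ¬ (x 1 = 0 ∧ x 0 ≤ 0) → ∀ j : Fin 3,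
      ∃ D : EuclideanSpace ℝ (Fin 2) →L[ℝ] ℝ, HasFDerivAt (n j) D x ∧
        ‖D‖ ≤ |deriv F ‖x‖| + |(N : ℝ)| * ‖x‖⁻¹ := by
    intro x hx j
    have hx0 : x ≠ 0 := by
      rintro rfl
      simp at hx
    have hnhds := isOpen_compl_nonpos_axis.mem_nhds hx
    have hFx : DifferentiableAt ℝ F ‖x‖ :=
      (hF.differentiableOn one_ne_zero).differentiableAt (Ioi_mem_nhds (norm_pos_iff.mpr hx0))
    obtain ⟨U, hU, hU_le⟩ := exists_hasFDerivAt_comp_norm hx0 hFx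
    obtain ⟨V, hV, hV_le⟩ := exists_hasFDerivAt_polar_angle hx N
    have hUV := add_le_add hU_le hV_le
    have hsin := Real.abs_sin_le_one
    have hcos := Real.abs_cos_le_one
    have hneg (t : ℝ) : |-Real.sin t| ≤ 1 := by simpa using hsin t
    fin_cases j
    · obtain ⟨D, hD, hD_le⟩ := exists_hasFDerivAt_comp_mul_comp hU hV (Real.hasDerivAt_sin _)
        (Real.hasDerivAt_cos _) (hsin _) (hcos _) (hcos _) (hneg _)
      exact ⟨D, hD.congr_of_eventuallyEq (Filter.mem_of_superset hnhds hn0), hD_le.trans hUV⟩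
    · obtain ⟨D, hD, hD_le⟩ := exists_hasFDerivAt_comp_mul_comp hU hV (Real.hasDerivAt_sin _)
        (Real.hasDerivAt_sin _) (hsin _) (hsin _) (hcos _) (hcos _)
      exact ⟨D, hD.congr_of_eventuallyEq (Filter.mem_of_superset hnhds hn1), hD_le.trans hUV⟩
    · obtain ⟨D, hD, hD_le⟩ := exists_hasFDerivAt_comp_mul_comp hU hV (Real.hasDerivAt_cos _)
        (hasDerivAt_const _ (1 : ℝ)) (hcos _) (by simp) (hneg _) (by simp)
      simp only [mul_one] at hD
      exact ⟨D, hD.congr_of_eventuallyEq (Filter.mem_of_superset hnhds hn2), hD_le.trans hUV⟩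
  refine ⟨fun x hx j ↦ (key x hx j).choose_spec.1.differentiableAt, fun ε hε ↦ ?_⟩
  have hlim : Filter.Tendsto (fun r : ℝ ↦ |deriv F r| + |(N : ℝ)| * r⁻¹) Filter.atTop (𝓝 0) := by
    simpa using hF'.abs.add (tendsto_inv_atTop_zero.const_mul |(N : ℝ)|)
  obtain ⟨R, hR⟩ := Filter.eventually_atTop.mp (hlim.eventually_le_const hε)
  refine ⟨max R 1, by positivity, fun x hRx hx j ↦ ?_⟩
  obtain ⟨D, hD, hD_le⟩ := key x hx j
  rw [hD.fderiv]
  exact hD_le.trans (hR _ ((le_max_left _ _).trans hRx))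
end

section
/- For every real r > 0, | (π/(r+1)²)² − (sin(π/(r+1)) / r)² | ≤ (123/100)². -/
theorem cos_le_one_sub_sq_div_two_add_pow_four {x : ℝ} (hx : 0 ≤ x) :
    Real.cos x ≤ 1 - x ^ 2 / 2 + x ^ 4 / 24 := by
  have hmono : MonotoneOn (fun y : ℝ => 1 - y ^ 2 / 2 + y ^ 4 / 24 - Real.cos y) (Set.Ici 0) := by
    refine monotoneOn_of_hasDerivWithinAt_nonneg (convex_Ici 0) (by fun_prop)
      (f' := fun y => Real.sin y - (y - y ^ 3 / 6)) (fun y _ => ?_) (fun y hy => ?_)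
    · refine HasDerivAt.hasDerivWithinAt (HasDerivAt.congr_deriv ((((hasDerivAt_const y (1 : ℝ)).sub ((hasDerivAt_pow 2 y).div_const 2)).add
        ((hasDerivAt_pow 4 y).div_const 24)).sub (Real.hasDerivAt_cos y)) ?_)
      push_cast
      ring
    · rw [interior_Ici] at hy
      exact sub_nonneg.2 (Real.sin_ge_sub_cube (le_of_lt hy))
  have h := hmono (Set.self_mem_Ici) (Set.mem_Ici.2 hx) hx
  norm_num at h
  linarith

theorem sin_le_sub_cube_add_pow_five {x : ℝ} (hx : 0 ≤ x) :
    Real.sin x ≤ x - x ^ 3 / 6 + x ^ 5 / 120 := by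
  have hmono : MonotoneOn (fun y : ℝ => y - y ^ 3 / 6 + y ^ 5 / 120 - Real.sin y) (Set.Ici 0) := by
    refine monotoneOn_of_hasDerivWithinAt_nonneg (convex_Ici 0) (by fun_prop)
      (f' := fun y => 1 - y ^ 2 / 2 + y ^ 4 / 24 - Real.cos y) (fun y _ => ?_) (fun y hy => ?_)
    · refine HasDerivAt.hasDerivWithinAt (HasDerivAt.congr_deriv ((((hasDerivAt_id y).sub ((hasDerivAt_pow 3 y).div_const 6)).add
        ((hasDerivAt_pow 5 y).div_const 120)).sub (Real.hasDerivAt_sin y)) ?_)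
      push_cast
      ring
    · rw [interior_Ici] at hy
      exact sub_nonneg.2 (cos_le_one_sub_sq_div_two_add_pow_four (le_of_lt hy))
  have h := hmono (Set.self_mem_Ici) (Set.mem_Ici.2 hx) hx
  norm_num at h
  linarith

theorem pi_mul_mul_one_sub_le_sin {t : ℝ} (h0 : 0 ≤ t) (h1 : t ≤ 1) :
    Real.pi * (t * (1 - t)) ≤ Real.sin (Real.pi * t) := by
  have half : ∀ s : ℝ, 0 ≤ s → s ≤ 1 / 2 →
      Real.pi * (s * (1 - s)) ≤ Real.sin (Real.pi * s) := by
    intro s hs hs'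
    refine le_trans ?_ (Real.sin_ge_sub_cube (mul_nonneg Real.pi_pos.le hs))
    have hpi : Real.pi ^ 2 ≤ 12 := by nlinarith [Real.pi_lt_d4, Real.pi_pos]
    have key : 0 ≤ Real.pi * s ^ 2 * (1 - Real.pi ^ 2 * s / 6) :=
      mul_nonneg (by positivity) (by nlinarith)
    nlinarith
  rcases le_total t (1 / 2) with h | h
  · exact half t h0 h
  · have := half (1 - t) (by linarith) (by linarith)
    rw [show Real.pi * (1 - t) = Real.pi - Real.pi * t by ring, Real.sin_pi_sub] at this
    linarith

theorem sin_pi_mul_le {t : ℝ} (h0 : 0 ≤ t) :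
    Real.sin (Real.pi * t) ≤
      Real.pi * (t * (1 - 1644 / 1000 * t ^ 2 + 812 / 1000 * t ^ 4)) := by
  refine (sin_le_sub_cube_add_pow_five (mul_nonneg Real.pi_pos.le h0)).trans ?_
  have hl : 1644 / 1000 ≤ Real.pi ^ 2 / 6 := by nlinarith [Real.pi_gt_d4]
  have hu : Real.pi ^ 2 ≤ 98697 / 10000 := by nlinarith [Real.pi_lt_d4, Real.pi_pos]
  have hu' : Real.pi ^ 4 / 120 ≤ 812 / 1000 := by nlinarith [sq_nonneg Real.pi]
  have e : Real.pi * t - (Real.pi * t) ^ 3 / 6 + (Real.pi * t) ^ 5 / 120 =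
      Real.pi * (t * (1 - Real.pi ^ 2 / 6 * t ^ 2 + Real.pi ^ 4 / 120 * t ^ 4)) := by ring
  have hpi := Real.pi_pos
  rw [e]
  gcongr _ * (_ * (1 - ?_ * _ + ?_ * _))

theorem one_sub_sq_mul_sub_le {t : ℝ} (h0 : 0 ≤ t) (h1 : t ≤ 1) :
    (1 - t) ^ 2 * ((1 - 1644 / 1000 * t ^ 2 + 812 / 1000 * t ^ 4) ^ 2 - (1 - t) ^ 2)
      ≤ 1532 / 10000 := by
  rw [← sub_nonneg]
  rcases le_total t (1 / 5) with h | h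
  · have hw : 0 ≤ 1 - 5 * t := by linarith
    calc (0 : ℝ) ≤ 383/2500 * (1 - 5 * t) ^ 10
          + 283/250 * (5 * t) ^ 1 * (1 - 5 * t) ^ 9
          + 45319/12500 * (5 * t) ^ 2 * (1 - 5 * t) ^ 8
          + 102368/15625 * (5 * t) ^ 3 * (1 - 5 * t) ^ 7
          + 283681329/39062500 * (5 * t) ^ 4 * (1 - 5 * t) ^ 6
          + 244001428/48828125 * (5 * t) ^ 5 * (1 - 5 * t) ^ 5
          + 198235337/97656250 * (5 * t) ^ 6 * (1 - 5 * t) ^ 4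
          + 505125792/1220703125 * (5 * t) ^ 7 * (1 - 5 * t) ^ 3
          + 627863927/24414062500 * (5 * t) ^ 8 * (1 - 5 * t) ^ 2
          + 290493919/61035156250 * (5 * t) ^ 9 * (1 - 5 * t) ^ 1
          + 1617736431/610351562500 * (5 * t) ^ 10 := by
          positivity
      _ = _ := by ring
  · have hs : 0 ≤ 5 * t - 1 := by linarith
    have hw : 0 ≤ 5 - 5 * t := by linarith
    calc (0 : ℝ) ≤ 1617736431/640000000000000000 * (5 - 5 * t) ^ 10
          + 6926706479/64000000000000000 * (5 * t - 1) ^ 1 * (5 - 5 * t) ^ 9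
          + 61928400059/25600000000000000 * (5 * t - 1) ^ 2 * (5 - 5 * t) ^ 8
          + 7690062869/640000000000000 * (5 * t - 1) ^ 3 * (5 - 5 * t) ^ 7
          + 14046409847/512000000000000 * (5 * t - 1) ^ 4 * (5 - 5 * t) ^ 6
          + 1831614573/51200000000000 * (5 * t - 1) ^ 5 * (5 - 5 * t) ^ 5
          + 616850511/20480000000000 * (5 * t - 1) ^ 6 * (5 - 5 * t) ^ 4
          + 3561057/204800000000 * (5 * t - 1) ^ 7 * (5 - 5 * t) ^ 3
          + 10743651/1638400000000 * (5 * t - 1) ^ 8 * (5 - 5 * t) ^ 2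
          + 383/262144000 * (5 * t - 1) ^ 9 * (5 - 5 * t) ^ 1
          + 383/2621440000 * (5 * t - 1) ^ 10 := by
          positivity
      _ = _ := by ring

/-- For the profile function `F(r) = π/(r+1)` and topological invariant `N = 1`,
`|F'(r)² − ((1/r) sin F(r))²| ≤ (123/100)²` for every `r > 0`. -/
theorem stmt_12 :
    ∀ r : ℝ, 0 < r →
      |(Real.pi / (r + 1) ^ 2) ^ 2 - (Real.sin (Real.pi / (r + 1)) / r) ^ 2|
        ≤ (123 / 100) ^ 2 := by
  intro r hr
  obtain ⟨t, ht⟩ : ∃ t, t = r / (r + 1) := ⟨_, rfl⟩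
  have hr1 : 0 < r + 1 := by linarith
  have h0 : 0 < t := ht ▸ div_pos hr hr1
  have hst : 1 - t = 1 / (r + 1) := by rw [ht]; field_simp; ring
  have h1 : 0 < 1 - t := hst ▸ by positivity
  have hsin : Real.sin (Real.pi / (r + 1)) = Real.sin (Real.pi * t) := by
    rw [← Real.sin_pi_sub, ht]
    congr 1
    field_simp
    ring
  have hF : Real.pi / (r + 1) ^ 2 = Real.pi * (1 - t) ^ 2 := by
    rw [hst]
    field_simp
  have hr_inv : Real.sin (Real.pi * t) / r = (1 - t) * (Real.sin (Real.pi * t) / t) := by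
    rw [hst, ht]
    field_simp
  rw [hsin, hF, hr_inv]
  have hlow : Real.pi * (1 - t) ≤ Real.sin (Real.pi * t) / t := by
    rw [le_div_iff₀ h0]
    linarith [pi_mul_mul_one_sub_le_sin h0.le (by linarith : t ≤ 1)]
  have hup : Real.sin (Real.pi * t) / t ≤
      Real.pi * (1 - 1644 / 1000 * t ^ 2 + 812 / 1000 * t ^ 4) := by
    rw [div_le_iff₀ h0]
    linarith [sin_pi_mul_le h0.le]
  have hpos : 0 ≤ Real.pi * (1 - t) := by positivity
  have hlow2 := mul_le_mul_of_nonneg_left (pow_le_pow_left₀ hpos hlow 2) (sq_nonneg (1 - t))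
  have hup2 := mul_le_mul_of_nonneg_left
    (pow_le_pow_left₀ (hpos.trans hlow) hup 2) (sq_nonneg (1 - t))
  have hpoly := mul_le_mul_of_nonneg_left
    (one_sub_sq_mul_sub_le h0.le (by linarith : t ≤ 1)) (sq_nonneg Real.pi)
  have hpi : Real.pi ^ 2 ≤ 98697 / 10000 := by nlinarith [Real.pi_lt_d4, Real.pi_pos]
  rw [abs_le]
  constructor <;> linarith
end

section
/- For every ℓ ∈ ℤ, ∫₀¹ ( −4(3r² − 2)/(1 − r²)⁴ + (ℓ² + (ℓ+1)² − 2)/(2r²) ) · r³ · e^{−2/(1−r²)} dr ≤ (15 + 3ℓ² + 3(ℓ+1)²) · ∫₀¹ r³ · e^{−2/(1−r²)} dr. -/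
open MeasureTheory

/-- The weight `exp (-2 / (1 - r ^ 2))` dominates the fourth-order pole of `(1 - r ^ 2)⁻¹ ^ 4`. -/
lemma exp_neg_two_div_div_pow_four_le {w : ℝ} (hw : 0 < w) :
    Real.exp (-2 / w) / w ^ 4 ≤ 3 / 2 := by
  have h := Real.pow_div_factorial_le_exp (2 / w) (by positivity) 4
  have hE : Real.exp (-2 / w) = (Real.exp (2 / w))⁻¹ := by rw [← Real.exp_neg]; ring_nf
  rw [hE, div_le_iff₀ (by positivity), inv_le_comm₀ (by positivity) (by positivity)]
  refine le_trans (le_of_eq ?_) h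
  simp only [Nat.factorial]
  field_simp
  norm_num

lemma one_sub_sq_pos {r : ℝ} (hr : r ∈ Set.Ioo (0 : ℝ) 1) : 0 < 1 - r ^ 2 := by
  nlinarith [hr.1, hr.2]

lemma integrableOn_mul_exp_div_pow_four {c : ℝ → ℝ} (hc : ContinuousOn c (Set.Icc 0 1)) :
    IntegrableOn (fun r ↦ c r * (Real.exp (-2 / (1 - r ^ 2)) / (1 - r ^ 2) ^ 4))
      (Set.Ioo (0 : ℝ) 1) := by
  rw [← integrableOn_Icc_iff_integrableOn_Ioo]
  refine IntegrableOn.continuousOn_mul hc ?_ isCompact_Icc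
  rw [integrableOn_Icc_iff_integrableOn_Ioo]
  refine Measure.integrableOn_of_bounded (M := 3 / 2) (by simp) ?_ ?_
  · exact Measurable.aestronglyMeasurable (by fun_prop)
  · filter_upwards [ae_restrict_mem measurableSet_Ioo] with r hr
    have hw := one_sub_sq_pos hr
    rw [Real.norm_of_nonneg (by positivity)]
    exact exp_neg_two_div_div_pow_four_le hw

/-- Denominator of the third convergent of the continued fraction of the exponential integral
`E₂ (2 / w)`, up to scaling. -/
def convergentDenom (w : ℝ) : ℝ := 1 + 6 * w + 9 * w ^ 2 + 3 * w ^ 3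

lemma convergentDenom_pos {w : ℝ} (hw : 0 ≤ w) : 0 < convergentDenom w := by
  unfold convergentDenom; positivity

/-- Rational prefactor, with the factor `(1 - r ^ 2)⁻¹ ^ 2` removed, of an antiderivative bounding
the difference of the two integrands from below. -/
noncomputable def prefactor (L w : ℝ) : ℝ :=
  -(1 / 2) * (2 - 6 * w + 3 * w ^ 2
    + (31 + 11 / 2 * L) * (w ^ 4 * (2 + 10 * w + 9 * w ^ 2) / (4 * convergentDenom w))
    - (15 + 3 * L) * w ^ 4 / 2)

noncomputable def boundDeriv (L r : ℝ) : ℝ :=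
  (15 + 3 * L) * (r ^ 3 * (1 - r ^ 2) ^ 4)
    - (-4 * (3 * r ^ 2 - 2) * r ^ 3 + (L - 2) / 2 * r * (1 - r ^ 2) ^ 4)
    - (31 + 11 / 2 * L) * (9 / 4) * r * (1 - r ^ 2) ^ 10 / convergentDenom (1 - r ^ 2) ^ 2

lemma hasDerivAt_prefactor_mul_exp (L : ℝ) {r : ℝ} (hr : 0 < 1 - r ^ 2) :
    HasDerivAt
      (fun r ↦ prefactor L (1 - r ^ 2) / (1 - r ^ 2) ^ 2 * Real.exp (-2 / (1 - r ^ 2)))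
      (boundDeriv L r * (Real.exp (-2 / (1 - r ^ 2)) / (1 - r ^ 2) ^ 4)) r := by
  have hq := (convergentDenom_pos hr.le).ne'
  have hw : HasDerivAt (fun r : ℝ ↦ 1 - r ^ 2) (-(2 * r)) r := by
    simpa using (hasDerivAt_pow 2 r).const_sub 1
  set w := 1 - r ^ 2 with hwdef
  have hx := hasDerivAt_id w
  have hden : HasDerivAt convergentDenom (6 + 18 * w + 9 * w ^ 2) w := by
    refine ((((hx.const_mul 6).const_add 1).add ((hx.pow 2).const_mul 9)).add
      ((hx.pow 3).const_mul 3)).congr_deriv ?_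
    simp only [id]; ring
  have hnum : HasDerivAt (fun w : ℝ ↦ w ^ 4 * (2 + 10 * w + 9 * w ^ 2))
      (8 * w ^ 3 + 50 * w ^ 4 + 54 * w ^ 5) w := by
    refine ((hx.pow 4).mul (((hx.const_mul 10).const_add 2).add
      ((hx.pow 2).const_mul 9))).congr_deriv ?_
    simp only [id, Pi.pow_apply, Pi.add_apply]; ring
  have hpoly : HasDerivAt (fun w : ℝ ↦ 2 - 6 * w + 3 * w ^ 2) (-6 + 6 * w) w := by
    refine (((hx.const_mul 6).const_sub 2).add ((hx.pow 2).const_mul 3)).congr_deriv ?_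
    simp only [id]; ring
  have hpre := ((hpoly.add ((hnum.div (hden.const_mul 4)
    (mul_ne_zero four_ne_zero hq)).const_mul (31 + 11 / 2 * L))).sub
    (((hx.pow 4).const_mul (15 + 3 * L)).div_const 2)).const_mul (-(1 / 2) : ℝ)
  have hexp := ((hasDerivAt_const w (-2 : ℝ)).div hx hr.ne').exp
  have hall := ((hpre.div (hx.pow 2) (pow_ne_zero 2 hr.ne')).mul hexp).comp r hw
  refine hall.congr_deriv ?_
  have hcube : r ^ 3 = r * (1 - w) := by rw [hwdef]; ring
  have hsq : r ^ 2 = 1 - w := by rw [hwdef]; ring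
  simp only [boundDeriv, hcube, hsq, sub_sub_cancel, Pi.add_apply, Pi.sub_apply,
    Pi.div_apply, Pi.pow_apply, id]
  simp only [convergentDenom] at hq ⊢
  field_simp
  ring

lemma prefactor_one_nonpos {L : ℝ} (hL : 0 ≤ L) : prefactor L 1 ≤ 0 := by
  unfold prefactor convergentDenom
  linarith

lemma continuousOn_prefactor (L : ℝ) : ContinuousOn (prefactor L) (Set.Ici 0) := by
  have h : ∀ w ∈ Set.Ici (0 : ℝ), 4 * convergentDenom w ≠ 0 := fun w hw ↦
    (mul_pos four_pos (convergentDenom_pos hw)).ne'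
  unfold prefactor
  unfold convergentDenom at *
  fun_prop (disch := assumption)

lemma continuousOn_boundDeriv (L : ℝ) : ContinuousOn (boundDeriv L) (Set.Icc 0 1) := by
  have h : ∀ r ∈ Set.Icc (0 : ℝ) 1, convergentDenom (1 - r ^ 2) ^ 2 ≠ 0 := fun r hr ↦
    pow_ne_zero 2 (convergentDenom_pos (by nlinarith [hr.1, hr.2])).ne'
  unfold boundDeriv
  unfold convergentDenom at *
  fun_prop (disch := assumption)

open Filter Topology in
lemma tendsto_prefactor_mul_exp (L : ℝ) :
    Tendsto (fun r ↦ prefactor L (1 - r ^ 2) / (1 - r ^ 2) ^ 2 * Real.exp (-2 / (1 - r ^ 2)))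
      (𝓝[<] 1) (𝓝 0) := by
  have hmem : ∀ᶠ r in 𝓝[<] (1 : ℝ), r ∈ Set.Ioo (0 : ℝ) 1 :=
    Ioo_mem_nhdsLT one_pos
  have hw : Tendsto (fun r : ℝ ↦ 1 - r ^ 2) (𝓝[<] 1) (𝓝[Set.Ici 0] 0) := by
    refine tendsto_nhdsWithin_iff.2 ⟨?_, hmem.mono fun r hr ↦ (one_sub_sq_pos hr).le⟩
    have : Continuous fun r : ℝ ↦ 1 - r ^ 2 := by fun_prop
    simpa using (this.tendsto 1).mono_left nhdsWithin_le_nhds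
  have hpre : Tendsto (fun w ↦ prefactor L w * w ^ 2) (𝓝[Set.Ici 0] 0) (𝓝 0) := by
    have h : ContinuousOn (fun w ↦ prefactor L w * w ^ 2) (Set.Ici 0) :=
      (continuousOn_prefactor L).mul (by fun_prop)
    simpa using (h 0 Set.self_mem_Ici).tendsto
  have hbd : IsBoundedUnder (· ≤ ·) (𝓝[<] (1 : ℝ))
      (norm ∘ fun r : ℝ ↦ Real.exp (-2 / (1 - r ^ 2)) / (1 - r ^ 2) ^ 4) := by
    refine isBoundedUnder_of_eventually_le (a := 3 / 2) (hmem.mono fun r hr ↦ ?_)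
    have hw := one_sub_sq_pos hr
    rw [Function.comp_apply, Real.norm_of_nonneg (by positivity)]
    exact exp_neg_two_div_div_pow_four_le hw
  refine ((hpre.comp hw).zero_mul_isBoundedUnder_le hbd).congr' (hmem.mono fun r hr ↦ ?_)
  have hw := (one_sub_sq_pos hr).ne'
  simp only [Function.comp_apply]
  field_simp

open Filter Topology in
lemma integral_boundDeriv_nonneg {L : ℝ} (hL : 0 ≤ L) :
    0 ≤ ∫ r in Set.Ioo (0 : ℝ) 1,
      boundDeriv L r * (Real.exp (-2 / (1 - r ^ 2)) / (1 - r ^ 2) ^ 4) := by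
  have hint := integrableOn_mul_exp_div_pow_four (continuousOn_boundDeriv L)
  have h0 := (hasDerivAt_prefactor_mul_exp L (r := 0) (by norm_num)).continuousAt.tendsto.mono_left
    (nhdsWithin_le_nhds (s := Set.Ioi 0))
  have h := intervalIntegral.integral_eq_sub_of_hasDerivAt_of_tendsto one_pos
    (fun r hr ↦ hasDerivAt_prefactor_mul_exp L (one_sub_sq_pos hr))
    ((intervalIntegrable_iff_integrableOn_Ioo_of_le zero_le_one).2 hint) h0
    (tendsto_prefactor_mul_exp L)
  rw [← integral_Ioc_eq_integral_Ioo, ← intervalIntegral.integral_of_le zero_le_one, h]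
  simpa using mul_nonpos_of_nonpos_of_nonneg (prefactor_one_nonpos hL) (Real.exp_pos (-2)).le

theorem stmt_15 (ℓ : ℤ) :
    (∫ r in Set.Ioo (0:ℝ) 1,
        (-4 * (3 * r ^ 2 - 2) / (1 - r ^ 2) ^ 4
          + ((ℓ : ℝ) ^ 2 + ((ℓ : ℝ) + 1) ^ 2 - 2) / (2 * r ^ 2))
          * r ^ 3 * Real.exp (-2 / (1 - r ^ 2)))
      ≤ (15 + 3 * (ℓ : ℝ) ^ 2 + 3 * ((ℓ : ℝ) + 1) ^ 2)
          * ∫ r in Set.Ioo (0:ℝ) 1, r ^ 3 * Real.exp (-2 / (1 - r ^ 2)) := by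
  set L : ℝ := (ℓ : ℝ) ^ 2 + ((ℓ : ℝ) + 1) ^ 2 with hLdef
  have hL : 0 ≤ L := by positivity
  have hcoef : 15 + 3 * (ℓ : ℝ) ^ 2 + 3 * ((ℓ : ℝ) + 1) ^ 2 = 15 + 3 * L := by
    rw [hLdef]; ring
  set M : ℝ → ℝ := fun r ↦ Real.exp (-2 / (1 - r ^ 2)) / (1 - r ^ 2) ^ 4 with hM
  set lower : ℝ → ℝ := fun r ↦
    -4 * (3 * r ^ 2 - 2) * r ^ 3 + (L - 2) / 2 * r * (1 - r ^ 2) ^ 4 with hlower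
  set upper : ℝ → ℝ := fun r ↦ (15 + 3 * L) * (r ^ 3 * (1 - r ^ 2) ^ 4) with hupper
  have hl : IntegrableOn (fun r ↦ lower r * M r) (Set.Ioo (0 : ℝ) 1) :=
    integrableOn_mul_exp_div_pow_four (by fun_prop)
  have hu : IntegrableOn (fun r ↦ upper r * M r) (Set.Ioo (0 : ℝ) 1) :=
    integrableOn_mul_exp_div_pow_four (by fun_prop)
  have hb : IntegrableOn (fun r ↦ boundDeriv L r * M r) (Set.Ioo (0 : ℝ) 1) :=
    integrableOn_mul_exp_div_pow_four (continuousOn_boundDeriv L)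
  rw [hcoef, ← integral_const_mul]
  calc
    _ = ∫ r in Set.Ioo (0 : ℝ) 1, lower r * M r := by
      refine setIntegral_congr_fun measurableSet_Ioo fun r hr ↦ ?_
      have hw := (one_sub_sq_pos hr).ne'
      have hr0 := hr.1.ne'
      simp only [hlower, hM]
      field_simp
    _ ≤ ∫ r in Set.Ioo (0 : ℝ) 1, (lower r * M r + boundDeriv L r * M r) := by
      rw [integral_add hl hb]
      linarith [integral_boundDeriv_nonneg hL]
    _ ≤ ∫ r in Set.Ioo (0 : ℝ) 1, upper r * M r := by
      refine setIntegral_mono_on (hl.add hb) hu measurableSet_Ioo fun r hr ↦ ?_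
      have hw := one_sub_sq_pos hr
      have hq := convergentDenom_pos hw.le
      have hr0 := hr.1
      have hMr : 0 ≤ M r := by simp only [hM]; positivity
      have hrem : 0 ≤ (31 + 11 / 2 * L) * (9 / 4) * r * (1 - r ^ 2) ^ 10
          / convergentDenom (1 - r ^ 2) ^ 2 := by positivity
      rw [← add_mul]
      refine mul_le_mul_of_nonneg_right ?_ hMr
      simp only [hlower, hupper, boundDeriv]
      linarith
    _ = _ := by
      refine setIntegral_congr_fun measurableSet_Ioo fun r hr ↦ ?_
      have hw := (one_sub_sq_pos hr).ne'
      simp only [hupper, hM]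
      field_simp
end

section
/- ∫₀¹ ( r³/(r+1)² ) · sin(π/(r+1)) · e^{−2/(1−r²)} dr ≥ (27/100) · ∫₀¹ r³ · e^{−2/(1−r²)} dr. -/
open MeasureTheory

/-- The polynomial `q` for which `r ^ 3 * q r * exp (-2 / (1 - r ^ 2))` is the derivative of
`r ^ 4 * (2 - 4 * r) / 25 * (1 - r ^ 2) ^ 2 * exp (-2 / (1 - r ^ 2))`. -/
noncomputable def bumpCorrector (r : ℝ) : ℝ :=
  (8 / 25 - 20 / 25 * r) * (1 - r ^ 2) ^ 2
    - 4 * r ^ 2 * (2 - r ^ 2) * (2 / 25 - 4 / 25 * r)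

theorem sin_pi_div_add_one_ge {r : ℝ} (h0 : 0 < r) (h1 : r < 1) :
    3 * (r / (r + 1)) - (3 * (r / (r + 1))) ^ 3 / 6 ≤ Real.sin (Real.pi / (r + 1)) := by
  have hs : 0 < r / (r + 1) := by positivity
  have hs' : r / (r + 1) ≤ 1 / 2 := by
    rw [div_le_div_iff₀ (by linarith) (by norm_num)]
    linarith
  have hpi := Real.pi_gt_three
  have hsin : Real.sin (Real.pi / (r + 1)) = Real.sin (Real.pi * (r / (r + 1))) := by
    rw [← Real.sin_pi_sub]
    congr 1
    field_simp
    ring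
  rw [hsin]
  refine (Real.sin_ge_sub_cube (by positivity)).trans ?_
  apply Real.sin_le_sin_of_le_of_le_pi_div_two
  · nlinarith
  · nlinarith
  · nlinarith

theorem profile_add_bumpCorrector_nonneg {r : ℝ} (h0 : 0 < r) (h1 : r < 1) :
    0 ≤ Real.sin (Real.pi / (r + 1)) / (r + 1) ^ 2 - 27 / 100 + bumpCorrector r := by
  have h1' : 0 < 1 - r := by linarith
  have hpos : 0 ≤ 1/20 * (r ^ 0 * (1 - r) ^ 14) + 63/20 * (r ^ 1 * (1 - r) ^ 13) + 1881/50 * (r ^ 2 * (1 - r) ^ 12)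
        + 10571/50 * (r ^ 3 * (1 - r) ^ 11) + 17201/25 * (r ^ 4 * (1 - r) ^ 10) + 34759/25 * (r ^ 5 * (1 - r) ^ 9)
        + 86927/50 * (r ^ 6 * (1 - r) ^ 8) + 30448/25 * (r ^ 7 * (1 - r) ^ 7) + 1241/4 * (r ^ 8 * (1 - r) ^ 6)
        + 263/100 * (r ^ 9 * (1 - r) ^ 5) + 16661/50 * (r ^ 10 * (1 - r) ^ 4) + 26329/50 * (r ^ 11 * (1 - r) ^ 3)
        + 16383/50 * (r ^ 12 * (1 - r) ^ 2) + 4621/50 * (r ^ 13 * (1 - r) ^ 1) + 91/10 * (r ^ 14 * (1 - r) ^ 0)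
        := by
    positivity
  have hkey : 0 ≤ (3 * (r / (r + 1)) - (3 * (r / (r + 1))) ^ 3 / 6) / (r + 1) ^ 2
      - 27 / 100 + bumpCorrector r := by
    refine (div_nonneg hpos (by positivity : 0 ≤ (r + 1) ^ 5)).trans_eq ?_
    unfold bumpCorrector
    field_simp
    ring
  have hdiv := div_le_div_of_nonneg_right (sin_pi_div_add_one_ge h0 h1)
    (by positivity : 0 ≤ (r + 1) ^ 2)
  linarith

theorem exp_neg_two_div_le_one {r : ℝ} (h0 : 0 < r) (h1 : r < 1) :
    Real.exp (-2 / (1 - r ^ 2)) ≤ 1 := by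
  rw [Real.exp_le_one_iff]
  exact div_nonpos_of_nonpos_of_nonneg (by norm_num) (by nlinarith)

theorem integrableOn_mul_exp_neg_two_div {f : ℝ → ℝ} (hf : Measurable f) (c : ℝ)
    (hc : ∀ r ∈ Set.Ioo (0 : ℝ) 1, |f r| ≤ c) :
    IntegrableOn (fun r => f r * Real.exp (-2 / (1 - r ^ 2))) (Set.Ioo (0 : ℝ) 1) := by
  refine Measure.integrableOn_of_bounded (M := c) (by simp)
    (by fun_prop : Measurable _).aestronglyMeasurable ?_
  refine (ae_restrict_iff' measurableSet_Ioo).2 (Filter.Eventually.of_forall fun r hr => ?_)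
  rw [Real.norm_eq_abs, abs_mul, Real.abs_exp]
  nlinarith [hc r hr, abs_nonneg (f r), exp_neg_two_div_le_one hr.1 hr.2,
    Real.exp_pos (-2 / (1 - r ^ 2))]

theorem hasDerivAt_bump_primitive {r : ℝ} (h0 : 0 < r) (h1 : r < 1) :
    HasDerivAt
      (fun x : ℝ => (x ^ 4 * (2 / 25 - 4 / 25 * x) * (1 - x ^ 2) ^ 2)
        * Real.exp (-2 / (1 - x ^ 2)))
      (r ^ 3 * bumpCorrector r * Real.exp (-2 / (1 - r ^ 2))) r := by
  have hne : 1 - r ^ 2 ≠ 0 := by nlinarith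
  have hu : HasDerivAt (fun x : ℝ => 1 - x ^ 2) (-(2 * r)) r := by
    simpa using (hasDerivAt_pow 2 r).const_sub 1
  have hl : HasDerivAt (fun x : ℝ => 2 / 25 - 4 / 25 * x) (-(4 / 25)) r := by
    simpa using ((hasDerivAt_id r).const_mul (4 / 25 : ℝ)).const_sub (2 / 25)
  have he := ((hasDerivAt_const r (-2 : ℝ)).fun_div hu hne).exp
  refine ((((hasDerivAt_pow 4 r).fun_mul hl).fun_mul (hu.fun_pow 2)).fun_mul he).congr_deriv ?_
  unfold bumpCorrector
  field_simp
  push_cast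
  ring

theorem integrableOn_cube_mul_bumpCorrector :
    IntegrableOn (fun r => r ^ 3 * bumpCorrector r * Real.exp (-2 / (1 - r ^ 2)))
      (Set.Ioo (0 : ℝ) 1) := by
  have hcont : Continuous fun r : ℝ => r ^ 3 * bumpCorrector r := by
    unfold bumpCorrector
    fun_prop
  obtain ⟨c, hc⟩ := (isCompact_Icc (a := (0 : ℝ)) (b := 1)).exists_bound_of_continuousOn
    hcont.continuousOn
  exact integrableOn_mul_exp_neg_two_div hcont.measurable c
    fun r hr => hc r (Set.Ioo_subset_Icc_self hr)

theorem integral_cube_mul_bumpCorrector :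
    ∫ r in Set.Ioo (0 : ℝ) 1, r ^ 3 * bumpCorrector r * Real.exp (-2 / (1 - r ^ 2)) = 0 := by
  have hlim (a : ℝ) (s : Set ℝ) (hs : Set.Ioo (0 : ℝ) 1 ∈ nhdsWithin a s)
      (ha : a ^ 4 * (2 / 25 - 4 / 25 * a) * (1 - a ^ 2) ^ 2 = 0) :
      Filter.Tendsto (fun x : ℝ => (x ^ 4 * (2 / 25 - 4 / 25 * x) * (1 - x ^ 2) ^ 2)
        * Real.exp (-2 / (1 - x ^ 2))) (nhdsWithin a s) (nhds 0) := by
    have hcont : Continuous fun x : ℝ => x ^ 4 * (2 / 25 - 4 / 25 * x) * (1 - x ^ 2) ^ 2 := by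
      fun_prop
    have hzero := ha ▸ (hcont.tendsto a).mono_left (nhdsWithin_le_nhds (s := s))
    refine hzero.zero_mul_isBoundedUnder_le (Filter.isBoundedUnder_of_eventually_le (a := 1) ?_)
    filter_upwards [hs] with x hx
    simpa only [Function.comp_apply, Real.norm_eq_abs, Real.abs_exp] using
      exp_neg_two_div_le_one hx.1 hx.2
  rw [← integral_Ioc_eq_integral_Ioo, ← intervalIntegral.integral_of_le zero_le_one]
  rw [intervalIntegral.integral_eq_sub_of_hasDerivAt_of_tendsto zero_lt_one
    (fun r hr => hasDerivAt_bump_primitive hr.1 hr.2)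
    ((intervalIntegrable_iff_integrableOn_Ioo_of_le zero_le_one).2
      integrableOn_cube_mul_bumpCorrector)
    (hlim 0 _ (Ioo_mem_nhdsGT zero_lt_one) (by norm_num))
    (hlim 1 _ (Ioo_mem_nhdsLT zero_lt_one) (by norm_num)), sub_zero]

theorem stmt_16 :
    (27 / 100) * (∫ r in Set.Ioo (0:ℝ) 1, r ^ 3 * Real.exp (-2 / (1 - r ^ 2)))
      ≤ ∫ r in Set.Ioo (0:ℝ) 1,
          (r ^ 3 / (r + 1) ^ 2) * Real.sin (Real.pi / (r + 1))
            * Real.exp (-2 / (1 - r ^ 2)) := by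
  have hcube : IntegrableOn (fun r : ℝ => r ^ 3 * Real.exp (-2 / (1 - r ^ 2)))
      (Set.Ioo (0 : ℝ) 1) := by
    refine integrableOn_mul_exp_neg_two_div (by fun_prop) 1 fun r hr => ?_
    rw [abs_of_nonneg (pow_nonneg hr.1.le 3)]
    exact pow_le_one₀ hr.1.le hr.2.le
  have hprofile : IntegrableOn (fun r : ℝ => (r ^ 3 / (r + 1) ^ 2)
      * Real.sin (Real.pi / (r + 1)) * Real.exp (-2 / (1 - r ^ 2))) (Set.Ioo (0 : ℝ) 1) := by
    refine integrableOn_mul_exp_neg_two_div (by fun_prop) 1 fun r hr => ?_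
    have h0 := hr.1
    have hfrac : |r ^ 3 / (r + 1) ^ 2| ≤ 1 := by
      rw [abs_of_nonneg (by positivity)]
      refine div_le_one_of_le₀ ?_ (by positivity)
      nlinarith [pow_le_one₀ (n := 3) hr.1.le hr.2.le]
    rw [abs_mul]
    exact mul_le_one₀ hfrac (abs_nonneg _) (Real.abs_sin_le_one _)
  have hpoint (r : ℝ) (hr : r ∈ Set.Ioo (0 : ℝ) 1) :
      27 / 100 * (r ^ 3 * Real.exp (-2 / (1 - r ^ 2)))
          - r ^ 3 * bumpCorrector r * Real.exp (-2 / (1 - r ^ 2))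
        ≤ (r ^ 3 / (r + 1) ^ 2) * Real.sin (Real.pi / (r + 1))
          * Real.exp (-2 / (1 - r ^ 2)) := by
    have hweight : 0 ≤ r ^ 3 * Real.exp (-2 / (1 - r ^ 2)) :=
      mul_nonneg (pow_nonneg hr.1.le 3) (Real.exp_pos _).le
    rw [← sub_nonneg]
    refine (mul_nonneg hweight (profile_add_bumpCorrector_nonneg hr.1 hr.2)).trans_eq ?_
    ring
  have hmono := setIntegral_mono_on
    ((hcube.const_mul (27 / 100)).sub integrableOn_cube_mul_bumpCorrector) hprofile
    measurableSet_Ioo hpoint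
  simp only [Pi.sub_apply] at hmono
  rwa [integral_sub (hcube.const_mul (27 / 100)) integrableOn_cube_mul_bumpCorrector,
    integral_const_mul, integral_cube_mul_bumpCorrector, sub_zero] at hmono
end
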